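/- For any a ∈ α, the étale phrases P^{1,1,1;l₁,l₂,l₃}_a and P^{1,1,1;m₁,m₂,m₃}_a (l₁ < l₂ < l₃, m₁ < m₂ < m₃ in {1,…,k}) are homotopic if and only if (l₁,l₂,l₃) = (m₁,m₂,m₃). Moreover, P^{2,1;l₁,l₂}_a is never homotopic to P^{1,1,1;m₁,m₂,m₃}_a. -/

import Mathlib

namespace Nano

variable {α : Type*}

/-- A letter: an identifier together with its projection to the alphabet `α`. -/
abbrev Letter (α : Type*) := ℕ × α

/-- The projection of a letter. -/
def proj (A : Letter α) : α := A.2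

/-- A phrase: a finite sequence of words, each word a list of letters. -/
abbrev Phrase (α : Type*) := List (List (Letter α))

/-- Flatten a phrase into one list, separating components by `none` (the `|` character). -/
def flat (P : Phrase α) : List (Option (Letter α)) :=
  List.intercalate [none] (P.map fun w => w.map some)

/-- The `i`-th component (word) of a phrase (0-indexed). -/
def comp (P : Phrase α) (i : ℕ) : List (Letter α) := P.getD i []

/-- A phrase is a Gauss phrase if every letter occurring in it occurs exactly twice. -/
def IsGauss [DecidableEq α] (P : Phrase α) : Prop :=
  ∀ A ∈ P.flatten, P.flatten.count A = 2

/-- All letters of `P` project into the subset `β` of `α`. -/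
def ProjIn (β : Set α) (P : Phrase α) : Prop := ∀ A ∈ P.flatten, A.2 ∈ β

/-- Renaming of letters (injective renamings give isomorphisms of `α`-alphabets,
preserving the projection). -/
def rename (f : ℕ → ℕ) (P : Phrase α) : Phrase α :=
  P.map (List.map fun A => (f A.1, A.2))

/-- One elementary step: an isomorphism or one of the homotopy moves (1)-(3),
for the involution `τ` on `α`. -/
inductive Move (τ : α → α) : Phrase α → Phrase α → Prop
  | iso (f : ℕ → ℕ) (hf : Function.Injective f) (P : Phrase α) :
      Move τ P (rename f P)
  | h1 (P Q : Phrase α) (A : Letter α) (x y : List (Option (Letter α)))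
      (hP : flat P = x ++ [some A, some A] ++ y)
      (hQ : flat Q = x ++ y) : Move τ P Q
  | h2 (P Q : Phrase α) (A B : Letter α) (x y z : List (Option (Letter α)))
      (hAB : B.2 = τ A.2)
      (hP : flat P = x ++ [some A, some B] ++ y ++ [some B, some A] ++ z)
      (hQ : flat Q = x ++ y ++ z) : Move τ P Q
  | h3 (P Q : Phrase α) (A B C : Letter α) (x y z t : List (Option (Letter α)))
      (hAB : A.2 = B.2) (hBC : B.2 = C.2)
      (hP : flat P = x ++ [some A, some B] ++ y ++ [some A, some C] ++ z
              ++ [some B, some C] ++ t)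
      (hQ : flat Q = x ++ [some B, some A] ++ y ++ [some C, some A] ++ z
              ++ [some C, some B] ++ t) : Move τ P Q

/-- A nanophrase over the subset `β`: a Gauss phrase all of whose letters project into `β`. -/
def NanoIn [DecidableEq α] (β : Set α) (P : Phrase α) : Prop := IsGauss P ∧ ProjIn β P

/-- Homotopy of nanophrases in the class of nanophrases over `β ⊆ α`:
a finite chain of isomorphisms, moves (1)-(3) and their inverses, all whose
terms are nanophrases over `β`. -/
def HomotopicIn [DecidableEq α] (τ : α → α) (β : Set α) (P Q : Phrase α) : Prop :=
  Relation.ReflTransGen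
    (fun X Y => (Move τ X Y ∨ Move τ Y X) ∧ NanoIn β X ∧ NanoIn β Y) P Q

/-- Homotopy of nanophrases over `α`. -/
def Homotopic [DecidableEq α] (τ : α → α) (P Q : Phrase α) : Prop :=
  HomotopicIn τ Set.univ P Q

/-! ### Desingularization -/

/-- The letter `A_{p,q}` of the desingularized alphabet. -/
def dLetter (A : Letter α) (p q : ℕ) : Letter α := (Nat.pair A.1 (Nat.pair p q), A.2)

/-- The replacement of the `i`-th occurrence (1-indexed) of a letter `A` of
multiplicity `m`: `A_{1,i} A_{2,i} ⋯ A_{i-1,i} A_{i,i+1} ⋯ A_{i,m}`. -/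
def repl (A : Letter α) (i m : ℕ) : List (Letter α) :=
  ((List.range (i - 1)).map fun j => dLetter A (j + 1) i) ++
  ((List.range (m - i)).map fun j => dLetter A i (i + j + 1))

def desingWord [DecidableEq α] (m : Letter α → ℕ) :
    List (Letter α) → (Letter α → ℕ) → List (Letter α)
  | [], _ => []
  | A :: rest, seen =>
      repl A (seen A + 1) (m A) ++
        desingWord m rest (fun B => if B = A then seen B + 1 else seen B)

def desingAux [DecidableEq α] (m : Letter α → ℕ) :
    Phrase α → (Letter α → ℕ) → Phrase α
  | [], _ => []
  | w :: ws, seen => desingWord m w seen :: desingAux m ws (fun B => seen B + w.count B)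

/-- The desingularization `P^d` of an étale phrase `P`. -/
def desing [DecidableEq α] (P : Phrase α) : Phrase α :=
  desingAux (fun A => P.flatten.count A) P (fun _ => 0)

/-- Homotopy of étale phrases: homotopy of their desingularizations. -/
def EHomotopic [DecidableEq α] (τ : α → α) (P Q : Phrase α) : Prop :=
  Homotopic τ (desing P) (desing Q)

/-! ### Phrases over `α` itself, via the identity projection -/

/-- An element of `α` regarded as a letter (identity projection). -/
def ofα (a : α) : Letter α := (0, a)

/-- The empty phrase `(∅)_k` of length `k`. -/
def emptyP (k : ℕ) : Phrase α := List.replicate k []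

/-- `P^{1,1;l₁,l₂}_a`. -/
def P11 (k : ℕ) (l1 l2 : Fin k) (a : α) : Phrase α :=
  List.ofFn fun i => if i = l1 ∨ i = l2 then [ofα a] else []

/-- `P^{3;l}_a`. -/
def P3 (k : ℕ) (l : Fin k) (a : α) : Phrase α :=
  List.ofFn fun i => if i = l then [ofα a, ofα a, ofα a] else []

/-- `P^{2,1;l₁,l₂}_a`. -/
def P21 (k : ℕ) (l1 l2 : Fin k) (a : α) : Phrase α :=
  List.ofFn fun i => if i = l1 then [ofα a, ofα a] else if i = l2 then [ofα a] else []

/-- `P^{1,2;l₁,l₂}_a`. -/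
def P12 (k : ℕ) (l1 l2 : Fin k) (a : α) : Phrase α :=
  List.ofFn fun i => if i = l1 then [ofα a] else if i = l2 then [ofα a, ofα a] else []

/-- `P^{1,1,1;l₁,l₂,l₃}_a`. -/
def P111 (k : ℕ) (l1 l2 l3 : Fin k) (a : α) : Phrase α :=
  List.ofFn fun i => if i = l1 ∨ i = l2 ∨ i = l3 then [ofα a] else []

/-! ### Linking numbers modulo two -/

/-- The letters of a flattened phrase, each tagged with the index of its component, when the
first component has index `n`. -/
def tag {β : Type*} : ℕ → List (Option β) → List (β × ℕ)
  | _, [] => []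
  | n, none :: l => tag (n + 1) l
  | n, some A :: l => (A, n) :: tag n l

/-- The letters of a phrase, each tagged with the index of its component, when the
first component has index `n`. -/
def tagPhrase {β : Type*} : ℕ → List (List β) → List (β × ℕ)
  | _, [] => []
  | n, w :: ws => w.map (fun A => (A, n)) ++ tagPhrase (n + 1) ws

lemma tag_append {β : Type*} (n : ℕ) (x y : List (Option β)) :
    tag n (x ++ y) = tag n x ++ tag (n + x.countP Option.isNone) y := by
  induction x generalizing n with
  | nil => simp [tag]
  | cons o x ih =>
    cases o with
    | none => simp [tag, ih, Nat.add_assoc, Nat.add_comm]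
    | some A => simp [tag, ih]

lemma tag_map_some {β : Type*} (n : ℕ) (w : List β) :
    tag n (w.map some) = w.map (fun A => (A, n)) := by
  induction w with
  | nil => rfl
  | cons A w ih => simp [tag, ih]

lemma tag_flat (n : ℕ) (P : Phrase α) : tag n (flat P) = tagPhrase n P := by
  induction P generalizing n with
  | nil => simp [flat, tag, tagPhrase]
  | cons w ws ih =>
    cases ws with
    | nil => simp [flat, tagPhrase, tag_map_some]
    | cons v vs =>
      have h : flat (w :: v :: vs) = w.map some ++ none :: flat (v :: vs) := by
        simp [flat]
      have h0 : (w.map some).countP Option.isNone = 0 := by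
        simp [List.countP_eq_zero]
      rw [h, tag_append, tag_map_some, h0, tagPhrase, ← ih]
      rfl

lemma map_fst_tagPhrase {β : Type*} (n : ℕ) (P : List (List β)) :
    (tagPhrase n P).map Prod.fst = P.flatten := by
  induction P generalizing n with
  | nil => rfl
  | cons w ws ih => simp [tagPhrase, ih, Function.comp_def]

lemma tagPhrase_rename (f : ℕ → ℕ) (n : ℕ) (P : Phrase α) :
    tagPhrase n (rename f P) =
      (tagPhrase n P).map (Prod.map (Prod.map f id) id) := by
  induction P generalizing n with
  | nil => rfl
  | cons w ws ih =>
    simp only [rename, List.map_cons, tagPhrase, List.map_append] at ih ⊢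
    rw [ih]
    simp [Function.comp_def]

lemma tagPhrase_replicate_append {β : Type*} (n m : ℕ) (P : List (List β)) :
    tagPhrase n (List.replicate m [] ++ P) = tagPhrase (n + m) P := by
  induction m generalizing n with
  | zero => simp
  | succ m ih =>
    simp only [List.replicate_succ, List.cons_append, tagPhrase, List.map_nil, List.nil_append, ih]
    congr 1
    omega

/-- The letters that occur both with tag `i` and with tag `j`. -/
def shared {β : Type*} [DecidableEq β] (T : List (β × ℕ)) (i j : ℕ) : Finset β :=
  {A ∈ (T.map Prod.fst).toFinset | (A, i) ∈ T ∧ (A, j) ∈ T}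

lemma mem_shared {β : Type*} [DecidableEq β] {T : List (β × ℕ)} {i j : ℕ} {A : β} :
    A ∈ shared T i j ↔ (A, i) ∈ T ∧ (A, j) ∈ T := by
  simp only [shared, Finset.mem_filter, List.mem_toFinset, List.mem_map, Prod.exists,
    exists_and_right, exists_eq_right, and_iff_right_iff_imp]
  exact fun h => ⟨i, h.1⟩

lemma shared_perm {β : Type*} [DecidableEq β] {T U : List (β × ℕ)} (h : T.Perm U) (i j : ℕ) :
    shared T i j = shared U i j := by
  ext A
  simp [mem_shared, h.mem_iff]

lemma shared_cons_cons_same {β : Type*} [DecidableEq β] {R : List (β × ℕ)} {A : β} {p i j : ℕ}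
    (hij : i ≠ j) (hA : A ∉ R.map Prod.fst) :
    shared ((A, p) :: (A, p) :: R) i j = shared R i j := by
  have hR : ∀ q, (A, q) ∉ R := fun q h => hA (List.mem_map_of_mem (f := Prod.fst) h)
  ext B
  simp only [mem_shared, List.mem_cons, Prod.mk.injEq]
  grind

lemma card_shared_two_pairs {β : Type*} [DecidableEq β] {R : List (β × ℕ)} {A B : β}
    {p q i j : ℕ} (hij : i ≠ j) (hAB : A ≠ B) (hA : A ∉ R.map Prod.fst)
    (hB : B ∉ R.map Prod.fst) :
    (shared ((A, p) :: (B, p) :: (B, q) :: (A, q) :: R) i j).card % 2 =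
      (shared R i j).card % 2 := by
  have hRA : ∀ q, (A, q) ∉ R := fun q h => hA (List.mem_map_of_mem (f := Prod.fst) h)
  have hRB : ∀ q, (B, q) ∉ R := fun q h => hB (List.mem_map_of_mem (f := Prod.fst) h)
  by_cases h : (i = p ∧ j = q) ∨ (i = q ∧ j = p)
  · have hS : shared ((A, p) :: (B, p) :: (B, q) :: (A, q) :: R) i j =
        insert A (insert B (shared R i j)) := by
      ext C
      simp only [mem_shared, List.mem_cons, Prod.mk.injEq, Finset.mem_insert]
      grind
    rw [hS, Finset.card_insert_of_notMem, Finset.card_insert_of_notMem]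
    · omega
    · simp [mem_shared, hRB]
    · simp [mem_shared, hRA, hAB]
  · congr 2
    ext C
    simp only [mem_shared, List.mem_cons, Prod.mk.injEq]
    grind

lemma card_shared_map {β γ : Type*} [DecidableEq β] [DecidableEq γ] {f : β → γ}
    (hf : Function.Injective f) (T : List (β × ℕ)) (i j : ℕ) :
    (shared (T.map (Prod.map f id)) i j).card = (shared T i j).card := by
  rw [← Finset.card_image_of_injective (shared T i j) hf]
  congr 1
  ext C
  simp only [mem_shared, List.mem_map, Prod.exists, Prod.map_apply, id, Prod.mk.injEq,
    Finset.mem_image]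
  constructor
  · rintro ⟨⟨A, _, h1, h2, rfl⟩, ⟨B, _, h3, h4, rfl⟩⟩
    obtain rfl : B = A := hf (h4.trans h2.symm)
    exact ⟨B, ⟨h1, h3⟩, h2⟩
  · rintro ⟨A, ⟨h1, h2⟩, h3⟩
    exact ⟨⟨A, i, h1, h3, rfl⟩, ⟨A, j, h2, h3, rfl⟩⟩

lemma IsGauss.count_tagPhrase [DecidableEq α] {P : Phrase α} (hP : IsGauss P) {A : Letter α}
    {n : ℕ} (hA : A ∈ (tagPhrase n P).map Prod.fst) :
    ((tagPhrase n P).map Prod.fst).count A = 2 := by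
  rw [map_fst_tagPhrase] at hA ⊢
  exact hP A hA

/-- The parity of the number of letters shared by two distinct components is preserved by each
elementary step. -/
lemma Move.card_shared_mod_two [DecidableEq α] {τ : α → α} {P Q : Phrase α} (h : Move τ P Q)
    (hP : IsGauss P) {i j : ℕ} (hij : i ≠ j) :
    (shared (tagPhrase 0 P) i j).card % 2 = (shared (tagPhrase 0 Q) i j).card % 2 := by
  cases h with
  | iso f hf =>
    rw [tagPhrase_rename, card_shared_map (hf.prodMap Function.injective_id)]
  | h1 _ _ A x y hx hy =>
    have hT := tag_flat 0 P
    have hU := tag_flat 0 Q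
    have hc := hP.count_tagPhrase (A := A) (n := 0)
    simp only [hx, hy, tag_append, tag, List.countP_append, List.countP_cons, List.countP_nil,
      Option.isNone_some, Bool.false_eq_true, if_false, Nat.add_zero, Nat.zero_add] at hT hU
    rw [← hT] at hc ⊢
    rw [← hU]
    have hperm : ∀ (X Y : List (Letter α × ℕ)) (s t : Letter α × ℕ),
        (X ++ [s, t] ++ Y).Perm (s :: t :: (X ++ Y)) := by
      intro X Y s t
      simp [← Multiset.coe_eq_coe, ← Multiset.coe_add, ← Multiset.cons_coe]
    rw [shared_perm (hperm _ _ _ _), shared_cons_cons_same hij]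
    rw [((hperm _ _ _ _).map _).count_eq] at hc
    simp only [((hperm _ _ _ _).map _).mem_iff] at hc
    simpa [List.count_eq_zero] using hc
  | h2 _ _ A B x y z hAB hx hy =>
    have hT := tag_flat 0 P
    have hU := tag_flat 0 Q
    have hcA := hP.count_tagPhrase (A := A) (n := 0)
    have hcB := hP.count_tagPhrase (A := B) (n := 0)
    simp only [hx, hy, tag_append, tag, List.countP_append, List.countP_cons, List.countP_nil,
      Option.isNone_some, Bool.false_eq_true, if_false, Nat.add_zero, Nat.zero_add] at hT hU
    rw [← hT] at hcA hcB ⊢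
    rw [← hU]
    have hperm : ∀ (X Y Z : List (Letter α × ℕ)) (s t u v : Letter α × ℕ),
        (X ++ [s, t] ++ Y ++ [u, v] ++ Z).Perm (s :: t :: u :: v :: (X ++ Y ++ Z)) := by
      intro X Y Z s t u v
      rw [← Multiset.coe_eq_coe]
      simp only [← Multiset.coe_add, ← Multiset.cons_coe, Multiset.coe_nil]
      simp only [← Multiset.singleton_add]
      abel
    rw [((hperm _ _ _ _ _ _ _).map _).count_eq] at hcA hcB
    simp only [((hperm _ _ _ _ _ _ _).map _).mem_iff] at hcA hcB
    have hne : A ≠ B := by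
      rintro rfl
      simp at hcA
    have hA := hcA (by simp)
    have hB := hcB (by simp)
    rw [shared_perm (hperm _ _ _ _ _ _ _), card_shared_two_pairs hij hne]
    · simpa [List.count_cons, hne, hne.symm, List.count_eq_zero] using hA
    · simpa [List.count_cons, hne, hne.symm, List.count_eq_zero] using hB
  | h3 _ _ A B C x y z t hAB hBC hx hy =>
    have hT := tag_flat 0 P
    have hU := tag_flat 0 Q
    simp only [hx, hy, tag_append, tag, List.countP_append, List.countP_cons, List.countP_nil,
      Option.isNone_some, Bool.false_eq_true, if_false, Nat.add_zero, Nat.zero_add] at hT hU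
    have hswap : ∀ s t : Letter α × ℕ, [s, t].Perm [t, s] := fun s t => .swap t s []
    rw [← hT, ← hU, shared_perm]
    exact ((((((List.Perm.refl _).append (hswap _ _)).append (.refl _)).append
      (hswap _ _)).append (.refl _)).append (hswap _ _)).append (.refl _)

lemma Homotopic.card_shared_mod_two [DecidableEq α] {τ : α → α} {P Q : Phrase α}
    (h : Homotopic τ P Q) {i j : ℕ} (hij : i ≠ j) :
    (shared (tagPhrase 0 P) i j).card % 2 = (shared (tagPhrase 0 Q) i j).card % 2 := by
  unfold Homotopic HomotopicIn at h
  induction h with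
  | refl => rfl
  | tail _ hs ih =>
    obtain ⟨hm | hm, hX, hY⟩ := hs
    · exact ih.trans (hm.card_shared_mod_two hX.1 hij)
    · exact ih.trans (hm.card_shared_mod_two hY.1 hij).symm

/-! ### The phrases `P^{1,1,1}` and `P^{2,1}` -/

lemma desingAux_replicate_append [DecidableEq α] (m : Letter α → ℕ) (n : ℕ) (P : Phrase α)
    (seen : Letter α → ℕ) :
    desingAux m (List.replicate n [] ++ P) seen = List.replicate n [] ++ desingAux m P seen := by
  induction n with
  | zero => simp
  | succ n ih => simp [List.replicate_succ, desingAux, desingWord, ih]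

lemma desingAux_replicate [DecidableEq α] (m : Letter α → ℕ) (n : ℕ) (seen : Letter α → ℕ) :
    desingAux m (List.replicate n []) seen = List.replicate n [] := by
  simpa [desingAux] using desingAux_replicate_append m n [] seen

lemma tagPhrase_replicate {β : Type*} (n m : ℕ) :
    tagPhrase n (List.replicate m ([] : List β)) = [] := by
  simpa [tagPhrase] using tagPhrase_replicate_append n m ([] : List (List β))

lemma tagPhrase_desing_P111 [DecidableEq α] {k : ℕ} {l1 l2 l3 : Fin k} (h12 : l1 < l2)
    (h23 : l2 < l3) (a : α) :
    tagPhrase 0 (desing (P111 k l1 l2 l3 a)) =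
      [(dLetter (ofα a) 1 2, (l1 : ℕ)), (dLetter (ofα a) 1 3, (l1 : ℕ)),
        (dLetter (ofα a) 1 2, (l2 : ℕ)), (dLetter (ofα a) 2 3, (l2 : ℕ)),
        (dLetter (ofα a) 1 3, (l3 : ℕ)), (dLetter (ofα a) 2 3, (l3 : ℕ))] := by
  obtain ⟨l1, h1⟩ := l1
  obtain ⟨l2, h2⟩ := l2
  obtain ⟨l3, h3⟩ := l3
  simp only [Fin.mk_lt_mk] at h12 h23
  obtain ⟨q, rfl⟩ := Nat.exists_eq_add_of_lt h12
  obtain ⟨r, rfl⟩ := Nat.exists_eq_add_of_lt h23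
  obtain ⟨s, rfl⟩ := Nat.exists_eq_add_of_lt h3
  have hP : P111 _ ⟨l1, h1⟩ ⟨l1 + q + 1, h2⟩ ⟨l1 + q + 1 + r + 1, h3⟩ a =
      List.replicate l1 [] ++ [ofα a] :: (List.replicate q [] ++ [ofα a] ::
        (List.replicate r [] ++ [ofα a] :: List.replicate s [])) := by
    apply List.ext_getElem
    · simp [P111]; omega
    · intro i hi hi'
      simp only [P111, List.getElem_ofFn, Fin.ext_iff, List.getElem_append, List.getElem_cons,
        List.getElem_replicate, List.length_replicate]
      grind
  rw [hP]
  simp [desing, desingAux, desingWord, desingAux_replicate_append, desingAux_replicate,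
    tagPhrase, tagPhrase_replicate_append, tagPhrase_replicate, repl, List.range_succ]
  omega

lemma tagPhrase_desing_P21 [DecidableEq α] {k : ℕ} {l1 l2 : Fin k} (h12 : l1 < l2) (a : α) :
    tagPhrase 0 (desing (P21 k l1 l2 a)) =
      [(dLetter (ofα a) 1 2, (l1 : ℕ)), (dLetter (ofα a) 1 3, (l1 : ℕ)),
        (dLetter (ofα a) 1 2, (l1 : ℕ)), (dLetter (ofα a) 2 3, (l1 : ℕ)),
        (dLetter (ofα a) 1 3, (l2 : ℕ)), (dLetter (ofα a) 2 3, (l2 : ℕ))] := by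
  obtain ⟨l1, h1⟩ := l1
  obtain ⟨l2, h2⟩ := l2
  simp only [Fin.mk_lt_mk] at h12
  obtain ⟨q, rfl⟩ := Nat.exists_eq_add_of_lt h12
  obtain ⟨s, rfl⟩ := Nat.exists_eq_add_of_lt h2
  have hP : P21 _ ⟨l1, h1⟩ ⟨l1 + q + 1, h2⟩ a =
      List.replicate l1 [] ++ [ofα a, ofα a] :: (List.replicate q [] ++ [ofα a] ::
        List.replicate s []) := by
    apply List.ext_getElem
    · simp [P21]; omega
    · intro i hi hi'
      simp only [P21, List.getElem_ofFn, Fin.ext_iff, List.getElem_append, List.getElem_cons,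
        List.getElem_replicate, List.length_replicate]
      grind
  rw [hP]
  simp [desing, desingAux, desingWord, desingAux_replicate_append, desingAux_replicate,
    tagPhrase, tagPhrase_replicate_append, tagPhrase_replicate, repl, List.range_succ]
  omega

lemma dLetter_inj {A : Letter α} {p q r s : ℕ} :
    dLetter A p q = dLetter A r s ↔ p = r ∧ q = s := by
  simp [dLetter, Nat.pair_eq_pair]

/-- Two distinct components of the desingularization of `P^{1,1,1}` share an odd number of
letters exactly when both are nonempty. -/
lemma card_shared_P111_mod_two [DecidableEq α] {k : ℕ} {l1 l2 l3 : Fin k} (h12 : l1 < l2)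
    (h23 : l2 < l3) (a : α) {i j : Fin k} (hij : i ≠ j) :
    (shared (tagPhrase 0 (desing (P111 k l1 l2 l3 a))) i j).card % 2 = 1 ↔
      (i = l1 ∨ i = l2 ∨ i = l3) ∧ (j = l1 ∨ j = l2 ∨ j = l3) := by
  rw [tagPhrase_desing_P111 h12 h23]
  have hAB : dLetter (ofα a) 1 2 ≠ dLetter (ofα a) 1 3 := by simp [dLetter_inj]
  have hAC : dLetter (ofα a) 1 2 ≠ dLetter (ofα a) 2 3 := by simp [dLetter_inj]
  have hBC : dLetter (ofα a) 1 3 ≠ dLetter (ofα a) 2 3 := by simp [dLetter_inj]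
  generalize dLetter (ofα a) 1 2 = A at *
  generalize dLetter (ofα a) 1 3 = B at *
  generalize dLetter (ofα a) 2 3 = C at *
  constructor
  · intro h
    obtain ⟨D, hD⟩ := Finset.card_pos.mp (Nat.odd_iff.mpr h).pos
    simp only [mem_shared, List.mem_cons, List.not_mem_nil, Prod.mk.injEq, or_false,
      Fin.val_inj] at hD
    grind
  · intro h
    have hS : ∃ D, shared [(A, (l1 : ℕ)), (B, (l1 : ℕ)), (A, (l2 : ℕ)), (C, (l2 : ℕ)),
        (B, (l3 : ℕ)), (C, (l3 : ℕ))] i j = {D} := by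
      have hne13 := h12.trans h23
      by_cases h3 : i = l3 ∨ j = l3
      · by_cases h2 : i = l2 ∨ j = l2
        · refine ⟨C, ?_⟩
          ext D
          simp only [mem_shared, List.mem_cons, List.not_mem_nil, Prod.mk.injEq, or_false,
            Fin.val_inj, Finset.mem_singleton]
          grind
        · refine ⟨B, ?_⟩
          ext D
          simp only [mem_shared, List.mem_cons, List.not_mem_nil, Prod.mk.injEq, or_false,
            Fin.val_inj, Finset.mem_singleton]
          grind
      · refine ⟨A, ?_⟩
        ext D
        simp only [mem_shared, List.mem_cons, List.not_mem_nil, Prod.mk.injEq, or_false,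
          Fin.val_inj, Finset.mem_singleton]
        grind
    obtain ⟨D, hD⟩ := hS
    simp [hD]

/-- Two distinct components of the desingularization of `P^{2,1}` share an even number of
letters. -/
lemma card_shared_P21_mod_two [DecidableEq α] {k : ℕ} {l1 l2 : Fin k} (h12 : l1 < l2) (a : α)
    {i j : Fin k} (hij : i ≠ j) :
    (shared (tagPhrase 0 (desing (P21 k l1 l2 a))) i j).card % 2 = 0 := by
  rw [tagPhrase_desing_P21 h12]
  have hAB : dLetter (ofα a) 1 2 ≠ dLetter (ofα a) 1 3 := by simp [dLetter_inj]
  have hAC : dLetter (ofα a) 1 2 ≠ dLetter (ofα a) 2 3 := by simp [dLetter_inj]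
  have hBC : dLetter (ofα a) 1 3 ≠ dLetter (ofα a) 2 3 := by simp [dLetter_inj]
  generalize dLetter (ofα a) 1 2 = A at *
  generalize dLetter (ofα a) 1 3 = B at *
  generalize dLetter (ofα a) 2 3 = C at *
  have hS : shared [(A, (l1 : ℕ)), (B, (l1 : ℕ)), (A, (l1 : ℕ)), (C, (l1 : ℕ)),
      (B, (l2 : ℕ)), (C, (l2 : ℕ))] i j = ∅ ∨
      shared [(A, (l1 : ℕ)), (B, (l1 : ℕ)), (A, (l1 : ℕ)), (C, (l1 : ℕ)),
      (B, (l2 : ℕ)), (C, (l2 : ℕ))] i j = {B, C} := by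
    by_cases h : (i = l1 ∧ j = l2) ∨ (i = l2 ∧ j = l1)
    · right
      ext D
      simp only [mem_shared, List.mem_cons, List.not_mem_nil, Prod.mk.injEq, or_false,
        Fin.val_inj, Finset.mem_insert, Finset.mem_singleton]
      grind
    · left
      ext D
      simp only [mem_shared, List.mem_cons, List.not_mem_nil, Prod.mk.injEq, or_false,
        Fin.val_inj, Finset.notMem_empty, iff_false]
      grind
  rcases hS with hS | hS <;> simp [hS, hBC]

/-- For any `a ∈ α`: the étale phrases `P^{1,1,1;l₁,l₂,l₃}_a` and
`P^{1,1,1;m₁,m₂,m₃}_a` (`l₁ < l₂ < l₃`, `m₁ < m₂ < m₃` in `{1,…,k}`) are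
homotopic if and only if `(l₁,l₂,l₃) = (m₁,m₂,m₃)`; moreover
`P^{2,1;l₁,l₂}_a` is never homotopic to `P^{1,1,1;m₁,m₂,m₃}_a`. -/
theorem P111_homotopic_iff_eq_and_P21_not_homotopic_P111
    {α : Type*} [Fintype α] [DecidableEq α] (τ : α → α) (hτ : Function.Involutive τ)
    (k : ℕ) (a : α) :
    (∀ l1 l2 l3 m1 m2 m3 : Fin k, l1 < l2 → l2 < l3 → m1 < m2 → m2 < m3 →
      (EHomotopic τ (P111 k l1 l2 l3 a) (P111 k m1 m2 m3 a) ↔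
        l1 = m1 ∧ l2 = m2 ∧ l3 = m3)) ∧
    (∀ l1 l2 m1 m2 m3 : Fin k, l1 < l2 → m1 < m2 → m2 < m3 →
      ¬ EHomotopic τ (P21 k l1 l2 a) (P111 k m1 m2 m3 a)) := by
  refine ⟨fun l1 l2 l3 m1 m2 m3 hl12 hl23 hm12 hm23 => ⟨fun h => ?_, ?_⟩,
    fun l1 l2 m1 m2 m3 hl12 hm12 hm23 h => ?_⟩
  · have key : ∀ i j : Fin k, i ≠ j →
        (i = l1 ∨ i = l2 ∨ i = l3) ∧ (j = l1 ∨ j = l2 ∨ j = l3) →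
        (i = m1 ∨ i = m2 ∨ i = m3) ∧ (j = m1 ∨ j = m2 ∨ j = m3) := by
      intro i j hij
      rw [← card_shared_P111_mod_two hl12 hl23 a hij, ← card_shared_P111_mod_two hm12 hm23 a hij,
        Homotopic.card_shared_mod_two h (Fin.val_ne_of_ne hij)]
      exact id
    have k12 := key l1 l2 hl12.ne (by simp)
    have k23 := key l2 l3 hl23.ne (by simp)
    simp only [Fin.ext_iff, Fin.lt_def] at *
    omega
  · rintro ⟨rfl, rfl, rfl⟩
    exact Relation.ReflTransGen.refl
  · have h1 := Homotopic.card_shared_mod_two h (Fin.val_ne_of_ne hm12.ne)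
    rw [card_shared_P21_mod_two hl12 a hm12.ne,
      (card_shared_P111_mod_two hm12 hm23 a hm12.ne).mpr (by simp)] at h1
    exact absurd h1 (by decide)

end Nano
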